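/- Let W be the digraph with vertex set {a₁,b₁,c₁,d₁,a₂,b₂,c₂,d₂} and arc set {a₁→b₁, b₁→c₁, c₁→d₁, d₁→a₁, a₁→c₁, c₁→a₁, d₁→b₁, a₂→d₂, d₂→c₂, c₂→b₂, b₂→a₂, a₂→c₂, c₂→a₂, b₂→d₂, d₁→d₂, d₂→b₁, b₁→b₂, b₂→d₁}. Then W has no pair of arc-disjoint branchings consisting of an out-branching rooted at c₂ and an in-branching rooted at c₁. -/

import Mathlib

/-!
Digraphs are modelled by a finite vertex type `V` (with decidable equality) together with
an arc set `A : Finset (V × V)`; irreflexivity (`∀ e ∈ A, e.1 ≠ e.2`) is stated as a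
hypothesis.  Subdigraphs on a vertex set `S : Finset V` use arcs with both endpoints in `S`.
-/

variable {V : Type*} [Fintype V] [DecidableEq V]

/-- Reachability by a directed path using arcs of `B`. -/
def Reach (B : Finset (V × V)) : V → V → Prop :=
  Relation.ReflTransGen (fun u v => (u, v) ∈ B)

/-- `B` is an out-branching, rooted at `q`, of the digraph with vertex set `S`
and arc set `A`: a spanning subdigraph in which every vertex is reachable from `q`
and every vertex other than `q` has in-degree exactly one. -/
def IsOutBranching (S : Finset V) (A B : Finset (V × V)) (q : V) : Prop :=
  q ∈ S ∧ B ⊆ A ∧ (∀ e ∈ B, e.1 ∈ S ∧ e.2 ∈ S) ∧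
    (∀ v ∈ S, Reach B q v) ∧
    ∀ v ∈ S, v ≠ q → (B.filter (fun e => e.2 = v)).card = 1

/-- `B` is an in-branching, rooted at `r`, of the digraph with vertex set `S`
and arc set `A`: a spanning subdigraph in which `r` is reachable from every vertex
and every vertex other than `r` has out-degree exactly one. -/
def IsInBranching (S : Finset V) (A B : Finset (V × V)) (r : V) : Prop :=
  r ∈ S ∧ B ⊆ A ∧ (∀ e ∈ B, e.1 ∈ S ∧ e.2 ∈ S) ∧
    (∀ v ∈ S, Reach B v r) ∧
    ∀ v ∈ S, v ≠ r → (B.filter (fun e => e.1 = v)).card = 1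

/-- A good pair: an in-branching and an out-branching sharing no arc. -/
def GoodPair (S : Finset V) (A : Finset (V × V)) : Prop :=
  ∃ (I O : Finset (V × V)) (r q : V),
    IsInBranching S A I r ∧ IsOutBranching S A O q ∧ Disjoint I O

/-- A good `r`-pair: a good pair whose in-branching is rooted at `r`. -/
def GoodRPair (S : Finset V) (A : Finset (V × V)) (r : V) : Prop :=
  ∃ (I O : Finset (V × V)) (q : V),
    IsInBranching S A I r ∧ IsOutBranching S A O q ∧ Disjoint I O

/-- A good `(r,q)`-pair: in-branching rooted at `r`, out-branching rooted at `q`. -/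
def GoodRQPair (S : Finset V) (A : Finset (V × V)) (r q : V) : Prop :=
  ∃ I O : Finset (V × V),
    IsInBranching S A I r ∧ IsOutBranching S A O q ∧ Disjoint I O

/-- Number of arcs with tail in `X` and head outside `X`. -/
def cutCard (A : Finset (V × V)) (X : Finset V) : ℕ :=
  (A.filter (fun e => e.1 ∈ X ∧ e.2 ∉ X)).card

/-- Arc-connectivity is at least `k`. -/
def ArcConnAtLeast (A : Finset (V × V)) (k : ℕ) : Prop :=
  ∀ X : Finset V, X.Nonempty → X ≠ Finset.univ → k ≤ cutCard A X

/-- Arc-connectivity equals `k`. -/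
def ArcConnEq (A : Finset (V × V)) (k : ℕ) : Prop :=
  ArcConnAtLeast A k ∧ ∃ X : Finset V, X.Nonempty ∧ X ≠ Finset.univ ∧ cutCard A X = k

/-- `S` is an independent set: no two of its vertices are joined by an arc. -/
def IsIndep (A : Finset (V × V)) (S : Finset V) : Prop :=
  ∀ u ∈ S, ∀ v ∈ S, u ≠ v → (u, v) ∉ A ∧ (v, u) ∉ A

/-- The independence number is at most `k`. -/
def IndepNumLE (A : Finset (V × V)) (k : ℕ) : Prop :=
  ∀ S : Finset V, IsIndep A S → S.card ≤ k

/-- The independence number equals `k`. -/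
def IndepNumEq (A : Finset (V × V)) (k : ℕ) : Prop :=
  IndepNumLE A k ∧ ∃ S : Finset V, IsIndep A S ∧ S.card = k

/-- The subdigraph induced on `S` is semicomplete. -/
def SemicompleteOn (S : Finset V) (A : Finset (V × V)) : Prop :=
  ∀ u ∈ S, ∀ v ∈ S, u ≠ v → (u, v) ∈ A ∨ (v, u) ∈ A

/-- The digraph is co-bipartite. -/
def CoBipartite (A : Finset (V × V)) : Prop :=
  ∃ S : Finset V, SemicompleteOn S A ∧ SemicompleteOn Sᶜ A

/-- In-degree of a vertex. -/
def inDeg (A : Finset (V × V)) (v : V) : ℕ := (A.filter (fun e => e.2 = v)).card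

/-- Out-degree of a vertex. -/
def outDeg (A : Finset (V × V)) (v : V) : ℕ := (A.filter (fun e => e.1 = v)).card

/-- Minimum semidegree is at least `k`. -/
def MinSemidegreeGE (A : Finset (V × V)) (k : ℕ) : Prop :=
  ∀ v : V, k ≤ inDeg A v ∧ k ≤ outDeg A v

/-- Reachability by a directed path whose vertices all lie in `T`, using arcs of `A`. -/
def ReachInSet (T : Set V) (A : Finset (V × V)) : V → V → Prop :=
  Relation.ReflTransGen (fun a b => (a, b) ∈ A ∧ a ∈ T ∧ b ∈ T)

/-- The digraph `W`, with vertices `a₁=0, b₁=1, c₁=2, d₁=3, a₂=4, b₂=5, c₂=6, d₂=7`. -/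
def Wdigraph : Finset (Fin 8 × Fin 8) :=
  { (0, 1), (1, 2), (2, 3), (3, 0), (0, 2), (2, 0), (3, 1),
    (4, 7), (7, 6), (6, 5), (5, 4), (4, 6), (6, 4), (5, 7),
    (3, 7), (7, 1), (1, 5), (5, 3) }

/-- A directed path from inside `X` to outside `X` uses an arc leaving `X`. -/
theorem Reach.exists_arc_leaving {V : Type*} {B : Finset (V × V)}
    {u v : V} (h : Reach B u v) {X : Finset V} (hu : u ∈ X) (hv : v ∉ X) :
    ∃ e ∈ B, e.1 ∈ X ∧ e.2 ∉ X := by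
  induction h with
  | refl => exact absurd hu hv
  | @tail b c _ hbc ih =>
    by_cases hb : b ∈ X
    · exact ⟨(b, c), hbc, hb, hv⟩
    · exact ih hb

/-- An out-branching of `A` contains one of the arcs of `A` leaving a proper vertex subset that
contains the root. -/
theorem IsOutBranching.exists_mem_cut
    {A B : Finset (V × V)} {q : V} (h : IsOutBranching Finset.univ A B q) (X : Finset V)
    (hq : q ∈ X) (hX : ∃ v, v ∉ X) :
    ∃ e ∈ A.filter (fun e => e.1 ∈ X ∧ e.2 ∉ X), e ∈ B := by
  obtain ⟨-, hBA, -, hreach, -⟩ := h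
  obtain ⟨v, hv⟩ := hX
  obtain ⟨e, he, hcut⟩ := (hreach v (Finset.mem_univ v)).exists_arc_leaving hq hv
  exact ⟨e, Finset.mem_filter.2 ⟨hBA he, hcut⟩, he⟩

/-- An in-branching of `A` contains one of the arcs of `A` leaving a nonempty vertex subset that
avoids the root. -/
theorem IsInBranching.exists_mem_cut
    {A B : Finset (V × V)} {r : V} (h : IsInBranching Finset.univ A B r) (X : Finset V)
    (hX : X.Nonempty) (hr : r ∉ X) :
    ∃ e ∈ A.filter (fun e => e.1 ∈ X ∧ e.2 ∉ X), e ∈ B := by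
  obtain ⟨-, hBA, -, hreach, -⟩ := h
  obtain ⟨v, hv⟩ := hX
  obtain ⟨e, he, hcut⟩ := (hreach v (Finset.mem_univ v)).exists_arc_leaving hv hr
  exact ⟨e, Finset.mem_filter.2 ⟨hBA he, hcut⟩, he⟩

/-- `W` has no arc-disjoint pair consisting of an out-branching rooted
at `c₂` and an in-branching rooted at `c₁`. -/
theorem stmt15 :
    ¬ ∃ O I : Finset (Fin 8 × Fin 8),
        IsOutBranching Finset.univ Wdigraph O 6 ∧
        IsInBranching Finset.univ Wdigraph I 2 ∧
        Disjoint O I := by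
  rintro ⟨O, I, hO, hI, hdisj⟩
  have hne : ∀ e ∈ I, e ∉ O := fun e he he' => Finset.disjoint_left.1 hdisj he' he
  have outCut : ∀ X Y : Finset _, 6 ∈ X → (∃ v, v ∉ X) →
      Wdigraph.filter (fun e => e.1 ∈ X ∧ e.2 ∉ X) = Y → ∃ e ∈ Y, e ∈ O := by
    rintro X _ h6 hX rfl
    exact hO.exists_mem_cut X h6 hX
  have inCut : ∀ X Y : Finset _, X.Nonempty → 2 ∉ X →
      Wdigraph.filter (fun e => e.1 ∈ X ∧ e.2 ∉ X) = Y → ∃ e ∈ Y, e ∉ O := by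
    rintro X _ hX h2 rfl
    obtain ⟨e, he, heI⟩ := hI.exists_mem_cut X hX h2
    exact ⟨e, he, hne e heI⟩
  have o₁ := outCut {4, 6, 7} {(6, 5), (7, 1)} (by decide) (by decide) (by decide)
  have o₂ := outCut {0, 1, 2, 3, 4, 6, 7} {(6, 5), (1, 5)} (by decide) (by decide) (by decide)
  have o₃ := outCut {0, 1, 2, 3, 5, 6, 7} {(5, 4), (6, 4)} (by decide) (by decide) (by decide)
  have o₄ := outCut {1, 3, 4, 5, 6, 7} {(1, 2), (3, 0)} (by decide) (by decide) (by decide)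
  have o₅ := outCut {4, 5, 6, 7} {(7, 1), (5, 3)} (by decide) (by decide) (by decide)
  have o₆ := outCut {1, 4, 5, 6, 7} {(1, 2), (5, 3)} (by decide) (by decide) (by decide)
  have o₇ := outCut {0, 1, 3, 4, 5, 6, 7} {(1, 2), (0, 2)} (by decide) (by decide) (by decide)
  have o₈ := outCut {0, 1, 2, 3, 4, 5, 6} {(4, 7), (5, 7), (3, 7)}
    (by decide) (by decide) (by decide)
  have o₉ := outCut {0, 2, 3, 4, 5, 6, 7} {(0, 1), (3, 1), (7, 1)}
    (by decide) (by decide) (by decide)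
  have i₁ := inCut {6} {(6, 5), (6, 4)} (by decide) (by decide) (by decide)
  have i₂ := inCut {0} {(0, 1), (0, 2)} (by decide) (by decide) (by decide)
  have i₃ := inCut {1, 4, 5, 6, 7} {(1, 2), (5, 3)} (by decide) (by decide) (by decide)
  have i₄ := inCut {1} {(1, 2), (1, 5)} (by decide) (by decide) (by decide)
  have i₅ := inCut {4, 6} {(4, 7), (6, 5)} (by decide) (by decide) (by decide)
  have i₆ := inCut {4, 5, 6, 7} {(7, 1), (5, 3)} (by decide) (by decide) (by decide)
  have i₇ := inCut {4, 6, 7} {(6, 5), (7, 1)} (by decide) (by decide) (by decide)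
  have i₈ := inCut {3} {(3, 0), (3, 1), (3, 7)} (by decide) (by decide) (by decide)
  have i₉ := inCut {5} {(5, 4), (5, 7), (5, 3)} (by decide) (by decide) (by decide)
  simp only [Finset.exists_mem_insert, Finset.mem_singleton, exists_eq_left] at *
  clear hO hI hdisj hne outCut inCut
  grind
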